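/- Let k ≥ 2, set m = ⌈log₂(k+2)⌉, and suppose 2^m − C(m,⌊m/2⌋) ≤ k ≤ 2^m − 2. Then for every n ≥ 1, every D_k-free family F of subsets of [n] has Lubell function h̄(F) ≤ m + 1 − (2^m − k − 1)/C(m,⌊m/2⌋). -/

import Mathlib

open Finset

/-- The Lubell function of a family `F` of subsets of `[n]`. -/
noncomputable def lubell (n : ℕ) (F : Finset (Finset (Fin n))) : ℝ :=
  ∑ A ∈ F, (1 : ℝ) / (n.choose A.card)

/-- `F` is `D_k`-free: there are no pairwise distinct `A, B_1, …, B_k, C ∈ F`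
with `A ⊆ B_i ⊆ C` for all `i`. -/
def DkFree (n k : ℕ) (F : Finset (Finset (Fin n))) : Prop :=
  ¬ ∃ (A C : Finset (Fin n)) (B : Fin k → Finset (Fin n)),
      A ∈ F ∧ C ∈ F ∧ (∀ i, B i ∈ F) ∧
      Function.Injective B ∧ (∀ i, B i ≠ A ∧ B i ≠ C) ∧ A ≠ C ∧
      (∀ i, A ⊆ B i ∧ B i ⊆ C)

/-- The full chain attached to the permutation `σ` passes through `X`. -/
def Pass {n : ℕ} (σ : Equiv.Perm (Fin n)) (X : Finset (Fin n)) : Prop :=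
  ∀ z, z ∈ X ↔ (σ z).val < X.card

lemma pass_swap {n : ℕ} (σ : Equiv.Perm (Fin n)) (x y : Fin n) (X : Finset (Fin n)) :
    Pass (σ * Equiv.swap x y) X ↔ Pass σ (X.image (Equiv.swap x y)) := by
  have hc : (X.image (Equiv.swap x y)).card = X.card :=
    Finset.card_image_of_injective _ (Equiv.swap x y).injective
  have hmem : ∀ z, z ∈ X.image (Equiv.swap x y) ↔ Equiv.swap x y z ∈ X := by
    intro z
    rw [Finset.mem_image]
    constructor
    · rintro ⟨w, hw, rfl⟩
      simpa using hw
    · intro h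
      exact ⟨_, h, by simp⟩
  unfold Pass
  rw [hc]
  constructor
  · intro h z
    rw [hmem, h]
    simp
  · intro h z
    have := h (Equiv.swap x y z)
    rw [hmem] at this
    simpa using this

lemma image_swap_of_iff {n : ℕ} (x y : Fin n) (X : Finset (Fin n)) (h : x ∈ X ↔ y ∈ X) :
    X.image (Equiv.swap x y) = X := by
  ext z
  rw [Finset.mem_image]
  constructor
  · rintro ⟨w, hw, rfl⟩
    rw [Equiv.swap_apply_def]
    split_ifs <;> simp_all
  · intro hz
    refine ⟨Equiv.swap x y z, ?_, by simp⟩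
    rw [Equiv.swap_apply_def]
    split_ifs <;> simp_all

lemma Pass.subset_of_card_le {n : ℕ} {σ : Equiv.Perm (Fin n)} {X Y : Finset (Fin n)}
    (hX : Pass σ X) (hY : Pass σ Y) (h : X.card ≤ Y.card) : X ⊆ Y := by
  intro z hz
  rw [hY]
  rw [hX] at hz
  omega

lemma exists_pass {n : ℕ} (σ : Equiv.Perm (Fin n)) (j : ℕ) (hj : j ≤ n) :
    ∃ X : Finset (Fin n), Pass σ X ∧ X.card = j := by
  have hc : (Finset.univ.filter (fun z => (σ z).val < j)).card = j := by
    have : (Finset.univ.filter (fun z => (σ z).val < j)) =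
        (Finset.univ.filter (fun z : Fin n => z.val < j)).image σ.symm := by
      ext z
      simp only [Finset.mem_filter, Finset.mem_univ, true_and, Finset.mem_image]
      constructor
      · intro h
        exact ⟨σ z, h, by simp⟩
      · rintro ⟨w, hw, rfl⟩
        simpa using hw
    rw [this, Finset.card_image_of_injective _ σ.symm.injective, Fin.card_filter_val_lt]
    omega
  refine ⟨_, ?_, hc⟩
  intro z
  rw [hc]
  simp

open Classical in
/-- Equidistribution inside an interval, equal counts. -/
lemma count_eq {n : ℕ} (S : Finset (Equiv.Perm (Fin n))) (A B : Finset (Fin n))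
    (hswap : ∀ σ ∈ S, ∀ x ∈ B \ A, ∀ y ∈ B \ A, σ * Equiv.swap x y ∈ S)
    (t : ℕ) : ∀ X Y : Finset (Fin n), (X \ Y).card = t → X.card = Y.card →
      A ⊆ X → X ⊆ B → A ⊆ Y → Y ⊆ B →
      (S.filter (fun σ => Pass σ X)).card = (S.filter (fun σ => Pass σ Y)).card := by
  induction t with
  | zero =>
    intro X Y h0 hc _ _ _ _
    have : X ⊆ Y := by
      rwa [Finset.card_eq_zero, Finset.sdiff_eq_empty_iff_subset] at h0
    rw [Finset.eq_of_subset_of_card_le this hc.ge]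
  | succ t ih =>
    intro X Y h1 hc hAX hXB hAY hYB
    have h2 : (Y \ X).card = t + 1 := by
      rw [← h1]; exact (Finset.card_sdiff_comm hc).symm
    obtain ⟨x, hx⟩ := Finset.card_pos.mp (by omega : 0 < (X \ Y).card)
    obtain ⟨y, hy⟩ := Finset.card_pos.mp (by omega : 0 < (Y \ X).card)
    rw [Finset.mem_sdiff] at hx hy
    have hxBA : x ∈ B \ A := Finset.mem_sdiff.mpr ⟨hXB hx.1, fun h => hx.2 (hAY h)⟩
    have hyBA : y ∈ B \ A := Finset.mem_sdiff.mpr ⟨hYB hy.1, fun h => hy.2 (hAX h)⟩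
    have hxy : x ≠ y := by rintro rfl; exact hx.2 hy.1
    set Z := X.image (Equiv.swap x y) with hZ
    have hZ' : Z = insert y (X.erase x) := by
      ext z
      rw [hZ, Finset.mem_image, Finset.mem_insert, Finset.mem_erase]
      constructor
      · rintro ⟨w, hw, rfl⟩
        rw [Equiv.swap_apply_def]
        split_ifs with h1 h2
        · simp
        · subst h2; exact absurd hw hy.2
        · exact Or.inr ⟨h1, hw⟩
      · rintro (rfl | ⟨h1, h2⟩)
        · exact ⟨x, hx.1, by simp⟩
        · refine ⟨z, h2, Equiv.swap_apply_of_ne_of_ne h1 ?_⟩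
          rintro rfl; exact hy.2 h2
    have hZc : Z.card = X.card :=
      Finset.card_image_of_injective _ (Equiv.swap x y).injective
    have hXZ : (S.filter (fun σ => Pass σ X)).card = (S.filter (fun σ => Pass σ Z)).card := by
      refine Finset.card_bij' (fun σ _ => σ * Equiv.swap x y) (fun σ _ => σ * Equiv.swap x y)
        ?_ ?_ ?_ ?_
      · intro σ hσ
        rw [Finset.mem_filter] at hσ ⊢
        refine ⟨hswap σ hσ.1 x hxBA y hyBA, ?_⟩
        rw [pass_swap, hZ, Finset.image_image]
        have : (Equiv.swap x y : Fin n → Fin n) ∘ (Equiv.swap x y) = id := by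
          funext z; simp
        rw [this, Finset.image_id]; exact hσ.2
      · intro σ hσ
        rw [Finset.mem_filter] at hσ ⊢
        refine ⟨hswap σ hσ.1 x hxBA y hyBA, ?_⟩
        rw [pass_swap]; exact hσ.2
      · intro σ _; simp [mul_assoc]
      · intro σ _; simp [mul_assoc]
    rw [hXZ]
    apply ih Z Y
    · have : Z \ Y = (X \ Y).erase x := by
        rw [hZ']
        ext z
        simp only [Finset.mem_sdiff, Finset.mem_insert, Finset.mem_erase]
        constructor
        · rintro ⟨rfl | h, h2⟩
          · exact absurd hy.1 h2
          · exact ⟨h.1, h.2, h2⟩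
        · rintro ⟨h, h1, h2⟩
          exact ⟨Or.inr ⟨h, h1⟩, h2⟩
      rw [this, Finset.card_erase_of_mem (Finset.mem_sdiff.mpr hx), h1]; rfl
    · omega
    · intro z hz
      rw [hZ']
      refine Finset.mem_insert_of_mem (Finset.mem_erase.mpr ⟨?_, hAX hz⟩)
      rintro rfl; exact hx.2 (hAY hz)
    · intro z hz
      rw [hZ'] at hz
      rcases Finset.mem_insert.mp hz with rfl | h
      · exact hYB hy.1
      · exact hXB (Finset.mem_of_mem_erase h)
    · exact hAY
    · exact hYB

lemma card_level {n : ℕ} (A B : Finset (Fin n)) (hAB : A ⊆ B) (j : ℕ) (hj : A.card ≤ j) :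
    ((Finset.Icc A B).filter (fun X => X.card = j)).card =
      (B.card - A.card).choose (j - A.card) := by
  rw [← Finset.card_sdiff_of_subset hAB, ← Finset.card_powersetCard]
  refine Finset.card_bij' (fun X _ => X \ A) (fun Y _ => A ∪ Y) ?_ ?_ ?_ ?_
  · intro X hX
    simp only [Finset.mem_filter, Finset.mem_Icc] at hX
    rw [Finset.mem_powersetCard, Finset.card_sdiff_of_subset hX.1.1, hX.2]
    exact ⟨Finset.sdiff_subset_sdiff hX.1.2 (Finset.Subset.refl _), rfl⟩
  · intro Y hY
    rw [Finset.mem_powersetCard] at hY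
    have hd : Disjoint A Y := by
      rw [Finset.disjoint_left]; intro z hz hz'
      exact (Finset.mem_sdiff.mp (hY.1 hz')).2 hz
    simp only [Finset.mem_filter, Finset.mem_Icc]
    refine ⟨⟨Finset.subset_union_left, Finset.union_subset hAB
      (hY.1.trans Finset.sdiff_subset)⟩, ?_⟩
    rw [Finset.card_union_of_disjoint hd, hY.2]; omega
  · intro X hX
    simp only [Finset.mem_filter, Finset.mem_Icc] at hX
    exact Finset.union_sdiff_of_subset hX.1.1
  · intro Y hY
    rw [Finset.mem_powersetCard] at hY
    ext z
    simp only [Finset.mem_sdiff, Finset.mem_union]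
    constructor
    · rintro ⟨h1 | h1, h2⟩
      · exact absurd h1 h2
      · exact h1
    · intro h
      exact ⟨Or.inr h, (Finset.mem_sdiff.mp (hY.1 h)).2⟩

open Classical in
lemma count_mul {n : ℕ} (S : Finset (Equiv.Perm (Fin n))) (A B : Finset (Fin n))
    (hA : ∀ σ ∈ S, Pass σ A) (hB : ∀ σ ∈ S, Pass σ B)
    (hswap : ∀ σ ∈ S, ∀ x ∈ B \ A, ∀ y ∈ B \ A, σ * Equiv.swap x y ∈ S)
    (X : Finset (Fin n)) (hAX : A ⊆ X) (hXB : X ⊆ B) :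
    (B.card - A.card).choose (X.card - A.card) * (S.filter (fun σ => Pass σ X)).card
      = S.card := by
  have hcA := Finset.card_le_card hAX
  have hcB := Finset.card_le_card hXB
  set L := (Finset.Icc A B).filter (fun Y => Y.card = X.card) with hL
  have h1 : ∑ Y ∈ L, (S.filter (fun σ => Pass σ Y)).card =
      (B.card - A.card).choose (X.card - A.card) * (S.filter (fun σ => Pass σ X)).card := by
    rw [← card_level A B (hAX.trans hXB) _ hcA, ← smul_eq_mul, ← Finset.sum_const]
    refine Finset.sum_congr rfl ?_
    intro Y hY
    simp only [hL, Finset.mem_filter, Finset.mem_Icc] at hY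
    exact count_eq S A B hswap _ Y X rfl hY.2 hY.1.1 hY.1.2 hAX hXB
  rw [← h1]
  have h2 : ∑ Y ∈ L, (S.filter (fun σ => Pass σ Y)).card =
      ∑ σ ∈ S, (L.filter (fun Y => Pass σ Y)).card :=
    Finset.sum_card_bipartiteAbove_eq_sum_card_bipartiteBelow (fun Y σ => Pass σ Y)
  rw [h2, Finset.card_eq_sum_ones]
  refine Finset.sum_congr rfl ?_
  intro σ hσ
  rw [Finset.card_eq_one]
  have hn : X.card ≤ n := by simpa using Finset.card_le_univ X
  obtain ⟨Y, hY, hYc⟩ := exists_pass σ X.card hn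
  refine ⟨Y, ?_⟩
  ext Z
  simp only [hL, Finset.mem_filter, Finset.mem_Icc, Finset.mem_singleton]
  constructor
  · rintro ⟨⟨_, hZc⟩, hZ⟩
    exact Finset.Subset.antisymm (hZ.subset_of_card_le hY (by omega))
      (hY.subset_of_card_le hZ (by omega))
  · rintro rfl
    exact ⟨⟨⟨(hA σ hσ).subset_of_card_le hY (by omega),
      hY.subset_of_card_le (hB σ hσ) (by omega)⟩, hYc⟩, hY⟩

lemma pos_sum_le (m : ℕ) (d : ℕ) (hd : m ≤ d) :
    ∑ i ∈ Finset.range (d + 1), max 0 ((m.choose (m / 2) : ℝ) - d.choose i) ≤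
      (m + 1) * (m.choose (m / 2) : ℝ) - 2 ^ m := by
  induction d, hd using Nat.le_induction with
  | base =>
    have : ∀ i ∈ Finset.range (m + 1), max 0 ((m.choose (m / 2) : ℝ) - m.choose i) =
        (m.choose (m / 2) : ℝ) - m.choose i := by
      intro i _
      apply max_eq_right
      have : (m.choose i : ℝ) ≤ m.choose (m / 2) := by
        exact_mod_cast Nat.choose_le_middle i m
      linarith
    rw [Finset.sum_congr rfl this, Finset.sum_sub_distrib]
    have h2 : ∑ i ∈ Finset.range (m + 1), (m.choose i : ℝ) = 2 ^ m := by
      exact_mod_cast Nat.sum_range_choose m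
    rw [h2]; simp
  | succ d hd ih =>
    refine le_trans ?_ ih
    set M : ℝ := (m.choose (m / 2) : ℝ) with hM
    have e1 : d + 1 + 1 = d / 2 + (1 + (d + 1 - d / 2)) := by omega
    have e2 : d + 1 = d / 2 + (d + 1 - d / 2) := by omega
    have hz : max 0 (M - ((d + 1).choose (d / 2) : ℝ)) = 0 := by
      apply max_eq_left
      have : m.choose (m / 2) ≤ (d + 1).choose (d / 2) :=
        ((Nat.choose_le_choose (m / 2) hd).trans (Nat.choose_le_middle _ d)).trans
          (Nat.choose_le_choose _ (Nat.le_succ d))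
      have : M ≤ ((d + 1).choose (d / 2) : ℝ) := by rw [hM]; exact_mod_cast this
      linarith
    rw [e1, Finset.sum_range_add, Finset.sum_range_add]
    conv_rhs => rw [e2, Finset.sum_range_add]
    simp only [Finset.sum_range_one, add_zero, hz, zero_add]
    refine add_le_add (Finset.sum_le_sum ?_) (Finset.sum_le_sum ?_)
    · intro i _
      have : (d.choose i : ℝ) ≤ ((d + 1).choose i : ℝ) := by
        exact_mod_cast Nat.choose_le_choose _ (Nat.le_succ d)
      exact max_le_max le_rfl (by linarith)
    · intro i _
      have : (d.choose (d / 2 + i) : ℝ) ≤ ((d + 1).choose (d / 2 + (1 + i)) : ℝ) := by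
        have h : d / 2 + (1 + i) = (d / 2 + i) + 1 := by ring
        rw [h, Nat.choose_succ_succ]
        push_cast
        have : (0 : ℝ) ≤ (d.choose (d / 2 + i + 1) : ℝ) := by positivity
        linarith
      exact max_le_max le_rfl (by linarith)

lemma sum_Icc_card {n : ℕ} (A B : Finset (Fin n)) (hAB : A ⊆ B) (f : ℕ → ℝ) :
    ∑ X ∈ Finset.Icc A B, f (X.card - A.card) =
      ∑ i ∈ Finset.range (B.card - A.card + 1), ((B.card - A.card).choose i : ℝ) * f i := by
  have hmaps : ∀ X ∈ Finset.Icc A B, X.card - A.card ∈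
      Finset.range (B.card - A.card + 1) := by
    intro X hX
    simp only [Finset.mem_Icc] at hX
    have := Finset.card_le_card hX.2
    rw [Finset.mem_range]; omega
  rw [← Finset.sum_fiberwise_of_maps_to hmaps]
  refine Finset.sum_congr rfl ?_
  intro i _
  have h1 : (Finset.Icc A B).filter (fun X => X.card - A.card = i) =
      (Finset.Icc A B).filter (fun X => X.card = A.card + i) := by
    apply Finset.filter_congr
    intro X hX
    simp only [Finset.mem_Icc] at hX
    have := Finset.card_le_card hX.1
    omega
  rw [h1, Finset.sum_congr rfl (g := fun _ => f i), Finset.sum_const,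
    card_level A B hAB _ (by omega), nsmul_eq_mul]
  · congr 3; omega
  · intro X hX
    rw [(Finset.mem_filter.mp hX).2]; congr 1; omega

lemma interval_bound {n : ℕ} (k m : ℕ) (hk2 : k + 2 ≤ 2 ^ m)
    (hk1 : 2 ^ m ≤ k + m.choose (m / 2)) (A B : Finset (Fin n)) (hAB : A ⊆ B)
    (G : Finset (Finset (Fin n))) (hG : G ⊆ Finset.Icc A B) (hGc : G.card ≤ k + 1) :
    ∑ X ∈ G, (1 : ℝ) / ((B.card - A.card).choose (X.card - A.card)) ≤
      (m : ℝ) + 1 - ((2 : ℝ) ^ m - k - 1) / (m.choose (m / 2)) := by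
  set d := B.card - A.card with hd
  set M : ℝ := (m.choose (m / 2) : ℝ) with hM
  have hMpos : 0 < M := by
    rw [hM]; exact_mod_cast Nat.choose_pos (Nat.div_le_self m 2)
  have hk1' : (2 : ℝ) ^ m ≤ k + M := by rw [hM]; exact_mod_cast hk1
  have hGc' : (G.card : ℝ) ≤ k + 1 := by exact_mod_cast hGc
  rcases Nat.lt_or_ge d m with h | h
  · have h1 : ∑ X ∈ G, (1 : ℝ) / (d.choose (X.card - A.card)) ≤ d + 1 := by
      calc _ ≤ ∑ X ∈ Finset.Icc A B, (1 : ℝ) / (d.choose (X.card - A.card)) :=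
            Finset.sum_le_sum_of_subset_of_nonneg hG (fun _ _ _ => by positivity)
        _ = ∑ i ∈ Finset.range (d + 1), (d.choose i : ℝ) * (1 / (d.choose i : ℝ)) :=
            sum_Icc_card A B hAB (fun i => (1 : ℝ) / (d.choose i))
        _ = ∑ i ∈ Finset.range (d + 1), (1 : ℝ) := by
            refine Finset.sum_congr rfl ?_
            intro i hi
            have : 0 < d.choose i := Nat.choose_pos (by simpa [Nat.lt_succ_iff] using hi)
            have : (d.choose i : ℝ) ≠ 0 := by exact_mod_cast this.ne'
            field_simp
        _ = d + 1 := by simp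
    have h2 : ((2 : ℝ) ^ m - k - 1) / M ≤ 1 := by
      rw [div_le_one hMpos]; linarith
    have h3 : (d : ℝ) + 1 ≤ m := by exact_mod_cast h
    linarith
  · have h1 : ∑ X ∈ G, (1 : ℝ) / (d.choose (X.card - A.card)) ≤
        ∑ X ∈ G, (max 0 (1 / (d.choose (X.card - A.card) : ℝ) - 1 / M) + 1 / M) := by
      refine Finset.sum_le_sum ?_
      intro X _
      have := le_max_right 0 (1 / (d.choose (X.card - A.card) : ℝ) - 1 / M)
      linarith
    have h2 : ∑ X ∈ G, max 0 (1 / (d.choose (X.card - A.card) : ℝ) - 1 / M) ≤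
        (1 / M) * ((m + 1) * M - 2 ^ m) := by
      calc _ ≤ ∑ X ∈ Finset.Icc A B, max 0 (1 / (d.choose (X.card - A.card) : ℝ) - 1 / M) :=
            Finset.sum_le_sum_of_subset_of_nonneg hG (fun _ _ _ => le_max_left _ _)
        _ = ∑ i ∈ Finset.range (d + 1),
              (d.choose i : ℝ) * max 0 (1 / (d.choose i : ℝ) - 1 / M) :=
            sum_Icc_card A B hAB (fun i => max 0 (1 / (d.choose i : ℝ) - 1 / M))
        _ = ∑ i ∈ Finset.range (d + 1), (1 / M) * max 0 (M - (d.choose i : ℝ)) := by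
            refine Finset.sum_congr rfl ?_
            intro i hi
            have : 0 < d.choose i := Nat.choose_pos (by simpa [Nat.lt_succ_iff] using hi)
            have : (0 : ℝ) < (d.choose i : ℝ) := by exact_mod_cast this
            rw [mul_max_of_nonneg _ _ this.le, mul_max_of_nonneg _ _ (by positivity)]
            congr 1
            · simp
            · field_simp
        _ = (1 / M) * ∑ i ∈ Finset.range (d + 1), max 0 (M - (d.choose i : ℝ)) := by
            rw [Finset.mul_sum]
        _ ≤ _ := by
            exact mul_le_mul_of_nonneg_left (pos_sum_le m d h) (by positivity)
    rw [Finset.sum_add_distrib, Finset.sum_const, nsmul_eq_mul] at h1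
    have h3 : (G.card : ℝ) * (1 / M) ≤ (k + 1) * (1 / M) :=
      mul_le_mul_of_nonneg_right hGc' (by positivity)
    have h4 : (1 / M) * ((m + 1) * M - 2 ^ m) + (k + 1) * (1 / M) =
        (m : ℝ) + 1 - ((2 : ℝ) ^ m - k - 1) / M := by
      field_simp; ring
    linarith

lemma interval_card {n k : ℕ} {F : Finset (Finset (Fin n))} (hF : DkFree n k F)
    {A B : Finset (Fin n)} (hA : A ∈ F) (hB : B ∈ F) :
    (F.filter (fun X => A ⊆ X ∧ X ⊆ B)).card ≤ k + 1 := by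
  by_contra hcon
  push Not at hcon
  set G := F.filter (fun X => A ⊆ X ∧ X ⊆ B) with hG
  have hne : A ≠ B := by
    rintro rfl
    have : G ⊆ {A} := by
      intro X hX
      have := (Finset.mem_filter.mp hX).2
      exact Finset.mem_singleton.mpr (Finset.Subset.antisymm this.2 this.1)
    have := Finset.card_le_card this
    rw [Finset.card_singleton] at this
    omega
  have hc : k ≤ ((G.erase A).erase B).card := by
    have h1 := Finset.pred_card_le_card_erase (s := G) (a := A)
    have h2 := Finset.pred_card_le_card_erase (s := G.erase A) (a := B)
    omega
  obtain ⟨H, hH, hHc⟩ := Finset.exists_subset_card_eq hc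
  have e := (H.equivFinOfCardEq hHc).symm
  have hmem : ∀ i, (e i : Finset (Fin n)) ≠ B ∧ (e i : Finset (Fin n)) ≠ A ∧
      (e i : Finset (Fin n)) ∈ F ∧ A ⊆ e i ∧ (e i : Finset (Fin n)) ⊆ B := by
    intro i
    have := hH (e i).2
    rw [Finset.mem_erase, Finset.mem_erase, hG, Finset.mem_filter] at this
    exact this
  exact hF ⟨A, B, fun i => e i, hA, hB, fun i => (hmem i).2.2.1,
    fun i j hij => e.injective (Subtype.ext hij),
    fun i => ⟨(hmem i).2.1, (hmem i).1⟩, hne, fun i => (hmem i).2.2.2⟩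

open Classical in
/-- Permutations whose chain has least element `p.1` and largest `p.2` in `F`. -/
noncomputable def fiberMM {n : ℕ} (F : Finset (Finset (Fin n)))
    (p : Finset (Fin n) × Finset (Fin n)) : Finset (Equiv.Perm (Fin n)) :=
  Finset.univ.filter (fun σ => Pass σ p.1 ∧ Pass σ p.2 ∧
    ∀ X ∈ F, Pass σ X → p.1 ⊆ X ∧ X ⊆ p.2)

lemma fiberMM_swap {n : ℕ} (F : Finset (Finset (Fin n))) (A B : Finset (Fin n)) (hAB : A ⊆ B) :
    ∀ σ ∈ fiberMM F (A, B), ∀ x ∈ B \ A, ∀ y ∈ B \ A,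
      σ * Equiv.swap x y ∈ fiberMM F (A, B) := by
  intro σ hσ x hx y hy
  rw [Finset.mem_sdiff] at hx hy
  simp only [fiberMM, Finset.mem_filter, Finset.mem_univ, true_and] at hσ ⊢
  obtain ⟨hA, hB, hall⟩ := hσ
  have hA' : Pass (σ * Equiv.swap x y) A := by
    rw [pass_swap, image_swap_of_iff _ _ _ (by simp [hx.2, hy.2])]; exact hA
  have hB' : Pass (σ * Equiv.swap x y) B := by
    rw [pass_swap, image_swap_of_iff _ _ _ (by simp [hx.1, hy.1])]; exact hB
  refine ⟨hA', hB', ?_⟩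
  intro X hXF hX
  constructor
  · rcases le_total A.card X.card with h | h
    · exact hA'.subset_of_card_le hX h
    · have hs := hX.subset_of_card_le hA' h
      have hX' := hX
      rw [pass_swap, image_swap_of_iff _ _ _
        (iff_of_false (fun h => hx.2 (hs h)) (fun h => hy.2 (hs h)))] at hX'
      exact (hall X hXF hX').1
  · rcases le_total X.card B.card with h | h
    · exact hX.subset_of_card_le hB' h
    · have hs := hB'.subset_of_card_le hX h
      have hX' := hX
      rw [pass_swap, image_swap_of_iff _ _ _ (iff_of_true (hs hx.1) (hs hy.1))] at hX'
      exact (hall X hXF hX').2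

open Classical in
lemma fiber_bound {n : ℕ} (k m : ℕ) (hk2 : k + 2 ≤ 2 ^ m)
    (hk1 : 2 ^ m ≤ k + m.choose (m / 2)) (F : Finset (Finset (Fin n))) (hF : DkFree n k F)
    (A B : Finset (Fin n)) (hA : A ∈ F) (hB : B ∈ F) :
    ∑ σ ∈ fiberMM F (A, B), ((F.filter (fun X => Pass σ X)).card : ℝ) ≤
      (fiberMM F (A, B)).card *
        ((m : ℝ) + 1 - ((2 : ℝ) ^ m - k - 1) / (m.choose (m / 2))) := by
  set S := fiberMM F (A, B) with hS
  have hSmem : ∀ σ ∈ S, Pass σ A ∧ Pass σ B ∧ ∀ X ∈ F, Pass σ X → A ⊆ X ∧ X ⊆ B := by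
    intro σ hσ
    simpa [hS, fiberMM] using hσ
  rcases S.eq_empty_or_nonempty with h0 | ⟨σ0, hσ0⟩
  · rw [h0]; simp
  have hAB : A ⊆ B := ((hSmem σ0 hσ0).2.2 A hA (hSmem σ0 hσ0).1).2
  set G := F.filter (fun X => A ⊆ X ∧ X ⊆ B) with hG
  have h1 : ∑ σ ∈ S, ((F.filter (fun X => Pass σ X)).card : ℝ) =
      ∑ X ∈ G, ((S.filter (fun σ => Pass σ X)).card : ℝ) := by
    have h2 : ∀ σ ∈ S, F.filter (fun X => Pass σ X) = G.filter (fun X => Pass σ X) := by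
      intro σ hσ
      ext X
      simp only [hG, Finset.mem_filter]
      constructor
      · rintro ⟨h1, h2⟩
        exact ⟨⟨h1, (hSmem σ hσ).2.2 X h1 h2⟩, h2⟩
      · rintro ⟨⟨h1, _⟩, h2⟩
        exact ⟨h1, h2⟩
    rw [Finset.sum_congr rfl (fun σ hσ => by rw [h2 σ hσ])]
    have := Finset.sum_card_bipartiteAbove_eq_sum_card_bipartiteBelow (s := S) (t := G)
      (fun σ X => Pass σ X)
    exact_mod_cast this
  have h3 : ∀ X ∈ G, ((S.filter (fun σ => Pass σ X)).card : ℝ) =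
      S.card * (1 / ((B.card - A.card).choose (X.card - A.card) : ℝ)) := by
    intro X hX
    have hX' := (Finset.mem_filter.mp hX).2
    have hc := count_mul S A B (fun σ hσ => (hSmem σ hσ).1) (fun σ hσ => (hSmem σ hσ).2.1)
      (fiberMM_swap F A B hAB) X hX'.1 hX'.2
    have hcB := Finset.card_le_card hX'.2
    have hpos : 0 < (B.card - A.card).choose (X.card - A.card) :=
      Nat.choose_pos (by omega)
    have hpos' : ((B.card - A.card).choose (X.card - A.card) : ℝ) ≠ 0 := by
      exact_mod_cast hpos.ne'
    rw [← hc]; push_cast; field_simp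
  rw [h1, Finset.sum_congr rfl h3, ← Finset.mul_sum]
  refine mul_le_mul_of_nonneg_left ?_ (by positivity)
  refine interval_bound k m hk2 hk1 A B hAB G ?_ (interval_card hF hA hB)
  intro X hX
  simpa using (Finset.mem_filter.mp hX).2

open Classical in
lemma lubell_eq {n : ℕ} (F : Finset (Finset (Fin n))) :
    (Fintype.card (Equiv.Perm (Fin n)) : ℝ) * lubell n F =
      ∑ σ : Equiv.Perm (Fin n), ((F.filter (fun X => Pass σ X)).card : ℝ) := by
  have h1 := Finset.sum_card_bipartiteAbove_eq_sum_card_bipartiteBelow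
    (s := (Finset.univ : Finset (Equiv.Perm (Fin n)))) (t := F) (fun σ X => Pass σ X)
  have h1' : ∑ σ : Equiv.Perm (Fin n), ((F.filter (fun X => Pass σ X)).card : ℝ) =
      ∑ X ∈ F, ((Finset.univ.filter
        (fun σ : Equiv.Perm (Fin n) => Pass σ X)).card : ℝ) := by
    exact_mod_cast h1
  rw [h1', lubell, Finset.mul_sum]
  refine Finset.sum_congr rfl ?_
  intro X _
  have hc := count_mul (Finset.univ : Finset (Equiv.Perm (Fin n))) ∅ Finset.univ
    (fun σ _ z => by simp) (fun σ _ z => by simp) (fun _ _ _ _ _ _ => Finset.mem_univ _)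
    X (Finset.empty_subset _) (Finset.subset_univ _)
  simp only [Finset.card_empty, Nat.sub_zero, Finset.card_univ, Fintype.card_fin] at hc
  have hpos : 0 < n.choose X.card :=
    Nat.choose_pos (by simpa using Finset.card_le_univ X)
  have hpos' : (n.choose X.card : ℝ) ≠ 0 := by exact_mod_cast hpos.ne'
  rw [← hc]; push_cast; field_simp


/-- For `k ≥ 2`, `m = ⌈log₂(k+2)⌉`, and `2^m - C(m,⌊m/2⌋) ≤ k ≤ 2^m - 2`,
every `D_k`-free family of subsets of `[n]` has Lubell function at most
`m + 1 - (2^m - k - 1)/C(m,⌊m/2⌋)`. -/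
theorem lubell_le_of_dkFree_case2 (k : ℕ) (hk : 2 ≤ k) (m : ℕ)
    (hm : m = Nat.clog 2 (k + 2))
    (hk1 : 2 ^ m - m.choose (m / 2) ≤ k) (hk2 : k ≤ 2 ^ m - 2)
    (n : ℕ) (hn : 1 ≤ n)
    (F : Finset (Finset (Fin n))) (hF : DkFree n k F) :
    lubell n F ≤ (m : ℝ) + 1 - ((2 : ℝ) ^ m - k - 1) / (m.choose (m / 2)) := by
  classical
  have hk2' : k + 2 ≤ 2 ^ m := by omega
  have hk1' : 2 ^ m ≤ k + m.choose (m / 2) := by omega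
  set U : ℝ := (m : ℝ) + 1 - ((2 : ℝ) ^ m - k - 1) / (m.choose (m / 2)) with hU
  have hU0 : 0 ≤ U := by
    have := interval_bound (n := n) k m hk2' hk1' ∅ ∅ (Finset.Subset.refl _) ∅
      (Finset.empty_subset _) (by simp)
    rwa [Finset.sum_empty] at this
  set N : ℝ := (Fintype.card (Equiv.Perm (Fin n)) : ℝ) with hN
  have hNpos : 0 < N := by rw [hN]; exact_mod_cast Fintype.card_pos
  refine le_of_mul_le_mul_left ?_ hNpos
  rw [lubell_eq]
  have hex : ∀ σ : Equiv.Perm (Fin n), ((F.filter (fun X => Pass σ X)).card : ℝ) ≤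
      ∑ p ∈ F ×ˢ F, if σ ∈ fiberMM F p then
        ((F.filter (fun X => Pass σ X)).card : ℝ) else 0 := by
    intro σ
    rcases (F.filter (fun X => Pass σ X)).eq_empty_or_nonempty with h0 | hne
    · rw [h0]; simp
    · obtain ⟨A, hA, hAmin⟩ := Finset.exists_min_image _ Finset.card hne
      obtain ⟨B, hB, hBmax⟩ := Finset.exists_max_image _ Finset.card hne
      rw [Finset.mem_filter] at hA hB
      have hmem : σ ∈ fiberMM F (A, B) := by
        simp only [fiberMM, Finset.mem_filter, Finset.mem_univ, true_and]
        refine ⟨hA.2, hB.2, fun X hXF hX => ?_⟩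
        have hX' := Finset.mem_filter.mpr ⟨hXF, hX⟩
        exact ⟨hA.2.subset_of_card_le hX (hAmin X hX'),
          hX.subset_of_card_le hB.2 (hBmax X hX')⟩
      have := Finset.single_le_sum (f := fun p => if σ ∈ fiberMM F p then
        ((F.filter (fun X => Pass σ X)).card : ℝ) else 0) (s := F ×ˢ F)
        (fun p _ => by split_ifs <;> positivity)
        (Finset.mem_product.mpr ⟨hA.1, hB.1⟩ : (A, B) ∈ F ×ˢ F)
      simpa only [hmem, if_true] using this
  have huniq : ∑ p ∈ F ×ˢ F, ((fiberMM F p).card : ℝ) ≤ N := by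
    have h1 := Finset.sum_card_bipartiteAbove_eq_sum_card_bipartiteBelow
      (s := F ×ˢ F) (t := (Finset.univ : Finset (Equiv.Perm (Fin n))))
      (fun p σ => σ ∈ fiberMM F p)
    have h2 : ∑ p ∈ F ×ˢ F, (fiberMM F p).card ≤ Fintype.card (Equiv.Perm (Fin n)) := by
      calc ∑ p ∈ F ×ˢ F, (fiberMM F p).card =
          ∑ p ∈ F ×ˢ F, (Finset.bipartiteAbove (fun p σ => σ ∈ fiberMM F p)
            (Finset.univ : Finset (Equiv.Perm (Fin n))) p).card := by
            refine Finset.sum_congr rfl fun p _ => ?_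
            congr 1
            ext σ
            simp [Finset.bipartiteAbove]
        _ = _ := h1
        _ ≤ ∑ σ : Equiv.Perm (Fin n), 1 := by
            refine Finset.sum_le_sum fun σ _ => ?_
            rw [Finset.card_le_one]
            rintro ⟨A, B⟩ hp ⟨A', B'⟩ hq
            simp only [Finset.bipartiteBelow, fiberMM, Finset.mem_filter, Finset.mem_product,
              Finset.mem_univ, true_and] at hp hq
            obtain ⟨⟨hAF, hBF⟩, hA, hB, hall⟩ := hp
            obtain ⟨⟨hAF', hBF'⟩, hA', hB', hall'⟩ := hq
            exact Prod.ext
              (Finset.Subset.antisymm (hall _ hAF' hA').1 (hall' _ hAF hA).1)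
              (Finset.Subset.antisymm (hall' _ hBF hB).2 (hall _ hBF' hB').2)
        _ = _ := by simp
    rw [hN]; exact_mod_cast h2
  calc ∑ σ : Equiv.Perm (Fin n), ((F.filter (fun X => Pass σ X)).card : ℝ)
      ≤ ∑ σ : Equiv.Perm (Fin n), ∑ p ∈ F ×ˢ F, (if σ ∈ fiberMM F p then
        ((F.filter (fun X => Pass σ X)).card : ℝ) else 0) :=
        Finset.sum_le_sum fun σ _ => hex σ
    _ = ∑ p ∈ F ×ˢ F, ∑ σ ∈ fiberMM F p, ((F.filter (fun X => Pass σ X)).card : ℝ) := by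
        rw [Finset.sum_comm]
        refine Finset.sum_congr rfl fun p _ => ?_
        rw [← Finset.sum_filter]
        congr 1
        ext σ
        simp
    _ ≤ ∑ p ∈ F ×ˢ F, ((fiberMM F p).card : ℝ) * U := by
        refine Finset.sum_le_sum fun p hp => ?_
        rw [Finset.mem_product] at hp
        exact fiber_bound k m hk2' hk1' F hF p.1 p.2 hp.1 hp.2
    _ = (∑ p ∈ F ×ˢ F, ((fiberMM F p).card : ℝ)) * U := by rw [Finset.sum_mul]
    _ ≤ N * U := mul_le_mul_of_nonneg_right huniq hU0
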